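/- arXiv:1809.06171 — 14 statements merged into one kernel-verified Lean document; each statement's English description precedes it below -/
import Mathlib

section
/- A Boolean relation R ⊆ {0,1}^k is balanced if and only if for every odd integer m ≥ 1, R is preserved by the alternating operation of arity m. -/
/-- The integer value of a Boolean. -/
def bInt (b : Bool) : ℤ := if b then 1 else 0

/-- The partial Boolean operation determined by integer coefficients `α`:
it is defined on a tuple `x` exactly when `∑ i, α i * x i ∈ {0,1}`,
and then returns that sum (as a Boolean). -/
def coeffOp {m : ℕ} (α : Fin m → ℤ) : (Fin m → Bool) → Option Bool :=
  fun x =>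
    if (∑ i, α i * bInt (x i)) = 1 then some true
    else if (∑ i, α i * bInt (x i)) = 0 then some false
    else none

/-- A partial Boolean operation is balanced if it is given by integer coefficients
summing to `1`, as in `coeffOp`. -/
def IsBalancedOp {m : ℕ} (f : (Fin m → Bool) → Option Bool) : Prop :=
  ∃ α : Fin m → ℤ, (∑ i, α i) = 1 ∧ f = coeffOp α

/-- A Boolean relation `R` of arity `n` is preserved by a partial Boolean operation `f`
of arity `m` if, applying `f` coordinatewise to any `m` tuples of `R`, whenever the
result is defined in every coordinate, the resulting tuple lies in `R`. -/
def Preserves {m n : ℕ} (f : (Fin m → Bool) → Option Bool)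
    (R : Set (Fin n → Bool)) : Prop :=
  ∀ t : Fin m → (Fin n → Bool), (∀ i, t i ∈ R) →
    ∀ w : Fin n → Bool, (∀ j, f (fun i => t i j) = some (w j)) → w ∈ R

/-- A Boolean relation is balanced if it is preserved by every balanced operation. -/
def IsBalancedRel {n : ℕ} (R : Set (Fin n → Bool)) : Prop :=
  ∀ (m : ℕ) (f : (Fin m → Bool) → Option Bool), IsBalancedOp f → Preserves f R

/-- The alternating operation of arity `m`: the balanced operation whose coefficients
alternate `+1, -1, +1, …`. -/
def altOp (m : ℕ) : (Fin m → Bool) → Option Bool :=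
  coeffOp (fun i : Fin m => (-1) ^ (i : ℕ))

/-- Every integer weighting of total weight `1` is an alternating sum of point weights. -/
lemma exists_alternating_sum_eq {ι : Type*} [Fintype ι] (α : ι → ℤ) (hα : ∑ i, α i = 1) :
    ∃ (k : ℕ) (s : ℕ → ι), ∀ g : ι → ℤ,
      ∑ i ∈ Finset.range (2 * k + 1), (-1) ^ i * g (s i) = ∑ j, α j * g j := by
  classical
  induction hN : ∑ i, (-α i).toNat using Nat.strong_induction_on generalizing α with
  | _ N ih =>
  obtain ⟨b, hb⟩ : ∃ b, 0 < α b := by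
    by_contra! h
    have := Finset.sum_nonpos fun i (_ : i ∈ Finset.univ) => h i
    omega
  by_cases hneg : ∃ a, α a < 0
  · obtain ⟨a, ha⟩ := hneg
    have hab : a ≠ b := by
      rintro rfl
      omega
    let β : ι → ℤ := fun i => α i + Pi.single (M := fun _ => ℤ) a 1 i
      - Pi.single (M := fun _ => ℤ) b 1 i
    obtain ⟨k, s, hs⟩ := ih (∑ i, (-β i).toNat) (by
      rw [← hN]
      refine Finset.sum_lt_sum (fun i _ => ?_) ⟨a, Finset.mem_univ a, ?_⟩
      · simp only [β, Pi.single_apply]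
        split_ifs <;> subst_vars <;> omega
      · simp only [β, Pi.single_apply, if_neg hab]
        simp
        omega) β (by simp [β, Finset.sum_add_distrib, hα]) rfl
    refine ⟨k + 1, fun i => i.casesOn b fun i => i.casesOn a s, fun g => ?_⟩
    rw [show 2 * (k + 1) + 1 = 2 * k + 1 + 1 + 1 by ring, Finset.sum_range_succ',
      Finset.sum_range_succ']
    have h := hs g
    simp only [β, sub_mul, add_mul, Finset.sum_add_distrib, Finset.sum_sub_distrib,
      Pi.single_apply, ite_mul, one_mul, zero_mul, Finset.sum_ite_eq', Finset.mem_univ,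
      if_true] at h
    simp only [pow_succ, mul_neg, mul_one, neg_neg, pow_zero, one_mul, neg_mul]
    change ∑ i ∈ Finset.range (2 * k + 1), (-1) ^ i * g (s i) + -g a + g b = _
    linarith
  · push Not at hneg
    have hzero : ∀ i ∈ Finset.univ, α i - Pi.single (M := fun _ => ℤ) b 1 i = 0 := by
      rw [← Finset.sum_eq_zero_iff_of_nonneg]
      · simp [hα]
      · intro i _
        have := hneg i
        rw [Pi.single_apply]
        split_ifs <;> subst_vars <;> omega
    refine ⟨0, fun _ => b, fun g => ?_⟩
    simp [fun i => sub_eq_zero.mp (hzero i (Finset.mem_univ i)), Pi.single_apply]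

/-- The coefficients of an alternating operation of odd arity sum to `1`. -/
lemma sum_neg_one_pow_eq_one {m : ℕ} (hm : Odd m) : ∑ i : Fin m, (-1 : ℤ) ^ (i : ℕ) = 1 := by
  rw [Fin.sum_univ_eq_sum_range (fun i => (-1 : ℤ) ^ i), neg_one_geom_sum,
    if_neg (Nat.not_even_iff_odd.mpr hm)]

/-- A Boolean relation `R ⊆ {0,1}^n` is balanced if and only if for every odd `m ≥ 1`,
`R` is preserved by the alternating operation of arity `m`. -/
theorem balanced_iff_preserved_by_alternating {n : ℕ} (R : Set (Fin n → Bool)) :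
    IsBalancedRel R ↔ ∀ m : ℕ, Odd m → Preserves (altOp m) R := by
  constructor
  · intro h m hm
    exact h m (altOp m) ⟨_, sum_neg_one_pow_eq_one hm, rfl⟩
  · rintro h m _ ⟨α, hα, rfl⟩ t ht w hw
    obtain ⟨k, s, hs⟩ := exists_alternating_sum_eq α hα
    refine h (2 * k + 1) (odd_two_mul_add_one k) (fun i => t (s i)) (fun i => ht _) w
      fun j => ?_
    rw [← hw j]
    simp only [altOp, coeffOp]
    rw [Fin.sum_univ_eq_sum_range (fun i => (-1 : ℤ) ^ i * bInt (t (s i) j)),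
      hs fun i => bInt (t i j)]
end

section
/- Let k ≥ 1 and let R ⊆ {0,1}^k be a Boolean relation with |R| < 2^k − 1. Then for every tuple u ∈ {0,1}^k \ R there exists a polynomial p_u in k variables over ℚ of total degree at most k − 1 that captures u with respect to R. -/
open MvPolynomial in
/-- The affine polynomial in the variable `i` whose value on a Boolean tuple `x` is `1` if
`x i = u i` and `0` otherwise. -/
noncomputable def agreementPoly {σ : Type*} (u : σ → Bool) (i : σ) : MvPolynomial σ ℚ :=
  if u i then X i else 1 - X i

theorem eval_agreementPoly {σ : Type*} (u x : σ → Bool) (i : σ) :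
    MvPolynomial.eval (fun i => if x i then (1 : ℚ) else 0) (agreementPoly u i) =
      if x i = u i then 1 else 0 := by
  unfold agreementPoly
  cases hu : u i <;> cases hx : x i <;> simp [hx]

theorem totalDegree_agreementPoly_le {σ : Type*} (u : σ → Bool) (i : σ) :
    (agreementPoly u i).totalDegree ≤ 1 := by
  unfold agreementPoly
  split_ifs
  · simp
  · exact (MvPolynomial.totalDegree_sub _ _).trans (by simp)

/-- Given a set `D` of coordinates, the polynomial that vanishes on a Boolean tuple `x` unless `x`
agrees with `u` outside `D` and the number of agreements inside `D` is `0` or at least `#D`. -/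
noncomputable def antipodalPoly {σ : Type*} [Fintype σ] [DecidableEq σ] (u : σ → Bool)
    (D : Finset σ) : MvPolynomial σ ℚ :=
  (∏ i ∈ Dᶜ, agreementPoly u i) *
    ∏ j ∈ Finset.Ico 1 D.card, (∑ i ∈ D, agreementPoly u i - MvPolynomial.C (j : ℚ))

theorem totalDegree_antipodalPoly_le {σ : Type*} [Fintype σ] [DecidableEq σ] (u : σ → Bool)
    {D : Finset σ} (hD : D.Nonempty) :
    (antipodalPoly u D).totalDegree ≤ Fintype.card σ - 1 := by
  have h₁ : (∏ i ∈ Dᶜ, agreementPoly u i).totalDegree ≤ Dᶜ.card := by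
    refine (MvPolynomial.totalDegree_finsetProd _ _).trans ?_
    simpa using Finset.sum_le_card_nsmul Dᶜ _ 1 fun i _ => totalDegree_agreementPoly_le u i
  have h₂ : (∏ j ∈ Finset.Ico 1 D.card,
      (∑ i ∈ D, agreementPoly u i - MvPolynomial.C (j : ℚ))).totalDegree ≤ D.card - 1 := by
    refine (MvPolynomial.totalDegree_finsetProd _ _).trans ?_
    refine (Finset.sum_le_card_nsmul _ _ 1 fun j _ => ?_).trans (by simp)
    refine (MvPolynomial.totalDegree_sub_C_le _ _).trans ?_
    exact MvPolynomial.totalDegree_finsetSum_le fun i _ => totalDegree_agreementPoly_le u i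
  have h₃ := MvPolynomial.totalDegree_mul (∏ i ∈ Dᶜ, agreementPoly u i)
    (∏ j ∈ Finset.Ico 1 D.card, (∑ i ∈ D, agreementPoly u i - MvPolynomial.C (j : ℚ)))
  have h₄ := D.card_add_card_compl
  have h₅ := hD.card_pos
  unfold antipodalPoly
  omega

theorem eval_antipodalPoly {σ : Type*} [Fintype σ] [DecidableEq σ] (u x : σ → Bool)
    (D : Finset σ) :
    MvPolynomial.eval (fun i => if x i then (1 : ℚ) else 0) (antipodalPoly u D) =
      (∏ i ∈ Dᶜ, if x i = u i then 1 else 0) *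
        ∏ j ∈ Finset.Ico 1 D.card, (((D.filter fun i => x i = u i).card : ℚ) - j) := by
  simp only [antipodalPoly, map_mul, map_prod, map_sub, map_sum, eval_agreementPoly,
    MvPolynomial.eval_C, Finset.sum_boole]

theorem eval_antipodalPoly_self_ne_zero {σ : Type*} [Fintype σ] [DecidableEq σ] (u : σ → Bool)
    (D : Finset σ) :
    MvPolynomial.eval (fun i => if u i then (1 : ℚ) else 0) (antipodalPoly u D) ≠ 0 := by
  simp only [eval_antipodalPoly, if_true, Finset.prod_const_one, one_mul, Finset.filter_true]
  refine Finset.prod_ne_zero_iff.2 fun j hj => sub_ne_zero.2 ?_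
  exact_mod_cast (Finset.mem_Ico.1 hj).2.ne'

theorem eval_antipodalPoly_eq_zero {σ : Type*} [Fintype σ] [DecidableEq σ] {u v x : σ → Bool}
    (hu : x ≠ u) (hv : x ≠ v) :
    MvPolynomial.eval (fun i => if x i then (1 : ℚ) else 0)
      (antipodalPoly u (Finset.univ.filter fun i => u i ≠ v i)) = 0 := by
  rw [eval_antipodalPoly]
  set D := Finset.univ.filter fun i => u i ≠ v i with hD
  by_cases h : ∀ i ∈ Dᶜ, x i = u i
  · refine mul_eq_zero_of_right _ ?_
    have hoff (i : σ) (hi : u i = v i) : x i = u i := h i (by simp [hD, hi])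
    obtain ⟨i, hi⟩ := Function.ne_iff.1 hu
    obtain ⟨j, hj⟩ := Function.ne_iff.1 hv
    have hiD : i ∈ D := by
      simpa [hD] using fun h' => hi (hoff i h')
    have hjD : j ∈ D := by
      simpa [hD] using fun h' => hj ((hoff j h').trans h')
    have hju : x j = u j := by
      have huv : u j ≠ v j := by simpa [hD] using hjD
      revert hj huv
      cases x j <;> cases u j <;> cases v j <;> simp
    refine Finset.prod_eq_zero (i := (D.filter fun i => x i = u i).card) ?_ (sub_self _)
    rw [Finset.mem_Ico]
    exact ⟨Finset.card_pos.2 ⟨j, Finset.mem_filter.2 ⟨hjD, hju⟩⟩,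
      Finset.card_lt_card (Finset.filter_ssubset.2 ⟨i, hiD, hi⟩)⟩
  · push Not at h
    obtain ⟨i, hi, hne⟩ := h
    exact mul_eq_zero_of_left (Finset.prod_eq_zero hi (if_neg hne)) _


/-- Let `k ≥ 1` and let `R ⊆ {0,1}^k` be a Boolean relation with `|R| < 2^k - 1`.
Then for every tuple `u ∈ {0,1}^k \ R` there is a polynomial in `k` variables over `ℚ`
of total degree at most `k - 1` that vanishes on all tuples of `R` but not on `u`
(i.e. captures `u` with respect to `R`). -/
theorem exists_capturing_polynomial_of_card_lt {k : ℕ} (hk : 1 ≤ k)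
    (R : Finset (Fin k → Bool)) (hR : R.card < 2 ^ k - 1)
    (u : Fin k → Bool) (hu : u ∉ R) :
    ∃ p : MvPolynomial (Fin k) ℚ, p.totalDegree ≤ k - 1 ∧
      (∀ x ∈ R, MvPolynomial.eval (fun i => if x i then (1 : ℚ) else 0) p = 0) ∧
      MvPolynomial.eval (fun i => if u i then (1 : ℚ) else 0) p ≠ 0 := by
  obtain ⟨v, hv⟩ : ∃ v, v ∉ insert u R := by
    by_contra! h
    have hcard := Finset.card_eq_iff_eq_univ (insert u R) |>.2 (Finset.eq_univ_iff_forall.2 h)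
    rw [Finset.card_insert_of_notMem hu] at hcard
    simp only [Fintype.card_pi, Fintype.card_bool, Finset.prod_const, Finset.card_univ,
      Fintype.card_fin] at hcard
    omega
  rw [Finset.mem_insert, not_or] at hv
  obtain ⟨i, hi⟩ := Function.ne_iff.1 hv.1
  refine ⟨antipodalPoly u (Finset.univ.filter fun i => u i ≠ v i), ?_, fun x hx => ?_,
    eval_antipodalPoly_self_ne_zero u _⟩
  · simpa using totalDegree_antipodalPoly_le u ⟨i, by simpa using hi.symm⟩
  · exact eval_antipodalPoly_eq_zero (fun h => hu (h ▸ hx)) fun h => hv.2 (h ▸ hx)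
end

section
/- Let R ⊆ {0,1}^k be a balanced Boolean relation. Then for every tuple u ∈ {0,1}^k \ R there exist a prime power q and a polynomial p(x_1,…,x_k) = α_0 + α_1 x_1 + ⋯ + α_k x_k of degree at most 1 over ℤ/qℤ that captures u with respect to R. -/
/-- A nonzero element of a finitely generated abelian group survives in some
cyclic quotient of prime power order. -/
theorem exists_addMonoidHom_zmod_apply_ne_zero {G : Type*} [AddCommGroup G] [AddGroup.FG G]
    {g : G} (hg : g ≠ 0) : ∃ q : ℕ, IsPrimePow q ∧ ∃ φ : G →+ ZMod q, φ g ≠ 0 := by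
  classical
  obtain ⟨n, ι, _, p, hp, e, ⟨E⟩⟩ := AddCommGroup.equiv_free_prod_directSum_zmod G
  have hEg : E g ≠ 0 := by simpa using hg
  by_cases h1 : (E g).1 = 0
  · have h2 : (E g).2 ≠ 0 := fun h => hEg (Prod.ext h1 h)
    obtain ⟨i, hi⟩ := DFinsupp.ne_iff.mp h2
    refine ⟨p i ^ e i, (hp i).isPrimePow.pow ?_,
      ((DFinsupp.evalAddMonoidHom i).comp (AddMonoidHom.snd _ _)).comp E.toAddMonoidHom, hi⟩
    intro he
    have : Subsingleton (ZMod (p i ^ e i)) := by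
      rw [he, pow_zero]
      infer_instance
    exact hi (Subsingleton.elim _ _)
  · obtain ⟨i, hi⟩ := DFunLike.ne_iff.mp h1
    obtain ⟨r, hr, hprime⟩ := Nat.exists_infinite_primes (((E g).1 i).natAbs + 1)
    refine ⟨r, hprime.isPrimePow,
      (((Int.castAddHom (ZMod r)).comp (Finsupp.applyAddHom i)).comp
        (AddMonoidHom.fst _ _)).comp E.toAddMonoidHom, ?_⟩
    change (((E g).1 i : ℤ) : ZMod r) ≠ 0
    rw [Ne, ZMod.intCast_zmod_eq_zero_iff_dvd]
    intro hdvd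
    exact hi (Int.eq_zero_of_dvd_of_natAbs_lt_natAbs hdvd (by simp; omega))

/-- The integer vector of a Boolean tuple, with a leading coordinate equal to `1`. -/
def homogenize {k : ℕ} (x : Fin k → Bool) : ℤ × (Fin k → ℤ) := (1, fun j => bInt (x j))

theorem coeffOp_eq_some_of_sum_eq {m : ℕ} {α : Fin m → ℤ} {x : Fin m → Bool} {b : Bool}
    (h : ∑ i, α i * bInt (x i) = bInt b) : coeffOp α x = some b := by
  cases b <;> simp_all [coeffOp, bInt]

theorem IsBalancedRel.mem_of_homogenize_mem_span {k : ℕ} {R : Set (Fin k → Bool)}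
    (hR : IsBalancedRel R) {u : Fin k → Bool}
    (h : homogenize u ∈ Submodule.span ℤ (Set.range fun x : R => homogenize x.1)) : u ∈ R := by
  classical
  have := Fintype.ofFinite R
  obtain ⟨c, hc⟩ := (Submodule.mem_span_range_iff_exists_fun ℤ).mp h
  let e := Fintype.equivFin R
  have hsum : ∑ x, c x = 1 := by
    simpa [homogenize, Prod.fst_sum] using congrArg Prod.fst hc
  have hcoord (j : Fin k) : ∑ x : R, c x * bInt (x.1 j) = bInt (u j) := by
    simpa [homogenize, Prod.snd_sum] using congrFun (congrArg Prod.snd hc) j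
  refine hR _ (coeffOp fun i => c (e.symm i)) ⟨_, ?_, rfl⟩ (fun i => (e.symm i).1)
    (fun i => (e.symm i).2) u fun j => coeffOp_eq_some_of_sum_eq ?_
  · rw [← hsum]
    exact Equiv.sum_comp e.symm c
  · rw [← hcoord j]
    exact Equiv.sum_comp e.symm fun x : R => c x * bInt (x.1 j)

theorem addMonoidHom_homogenize {k q : ℕ} (φ : ℤ × (Fin k → ℤ) →+ ZMod q) (x : Fin k → Bool) :
    φ (homogenize x) =
      φ (1, 0) + ∑ i, φ (0, Pi.single i 1) * (if x i then 1 else 0) := by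
  have h : homogenize x = (1, 0) + ∑ i, bInt (x i) • ((0, Pi.single i 1) : ℤ × (Fin k → ℤ)) := by
    ext j
    · simp [homogenize, Prod.fst_sum]
    · simp [homogenize, Prod.snd_sum, Finset.sum_apply, Pi.single_apply]
  rw [h, map_add, map_sum]
  congr 1
  refine Finset.sum_congr rfl fun i _ => ?_
  cases hx : x i <;> simp [bInt]

/-- Let `R ⊆ {0,1}^k` be a balanced Boolean relation. Then for every tuple
`u ∈ {0,1}^k \ R` there exist a prime power `q` and a degree-`≤ 1` polynomial
`α₀ + α₁ x₁ + ⋯ + α_k x_k` over `ℤ/qℤ` that captures `u` with respect to `R`: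
it vanishes on every tuple of `R` but not on `u`. -/
theorem balanced_implies_linear_polynomial {k : ℕ} (R : Set (Fin k → Bool))
    (hR : IsBalancedRel R) (u : Fin k → Bool) (hu : u ∉ R) :
    ∃ q : ℕ, IsPrimePow q ∧
      ∃ (α₀ : ZMod q) (α : Fin k → ZMod q),
        (∀ x ∈ R, α₀ + ∑ i, α i * (if x i then 1 else 0) = 0) ∧
        α₀ + ∑ i, α i * (if u i then 1 else 0) ≠ 0 := by
  let L := Submodule.span ℤ (Set.range fun x : R => homogenize x.1)
  have hne : L.mkQ (homogenize u) ≠ 0 := fun h =>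
    hu (hR.mem_of_homogenize_mem_span ((Submodule.Quotient.mk_eq_zero L).mp h))
  have : AddGroup.FG ((ℤ × (Fin k → ℤ)) ⧸ L) :=
    Module.Finite.iff_addGroup_fg.mp inferInstance
  obtain ⟨q, hq, φ, hφ⟩ := exists_addMonoidHom_zmod_apply_ne_zero hne
  let ψ := φ.comp L.mkQ.toAddMonoidHom
  refine ⟨q, hq, ψ (1, 0), fun i => ψ (0, Pi.single i 1), fun x hx => ?_, ?_⟩
  · rw [← addMonoidHom_homogenize]
    have hmem : homogenize x ∈ L := Submodule.subset_span ⟨⟨x, hx⟩, rfl⟩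
    change φ (L.mkQ (homogenize x)) = 0
    rw [Submodule.mkQ_apply, (Submodule.Quotient.mk_eq_zero L).mpr hmem, map_zero]
  · rw [← addMonoidHom_homogenize]
    exact hφ
end

section
/- Let s_1,…,s_m ∈ ℤ^n be the rows of an m×n integer matrix and let u ∈ ℤ^n. If for every prime power q it holds that u ∈ span_q({s_1,…,s_m}), then u ∈ span_ℤ({s_1,…,s_m}). -/
/-- An element of a finite module over a Noetherian ring that lies in `P ^ k • ⊤` for all maximal
ideals `P` and all `k` vanishes. -/
theorem eq_zero_of_forall_mem_maximal_pow_smul_top {R M : Type*} [CommRing R] [IsNoetherianRing R]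
    [AddCommGroup M] [Module R M] [Module.Finite R M] (x : M)
    (h : ∀ P : Ideal R, P.IsMaximal → ∀ k : ℕ, x ∈ (P ^ k • ⊤ : Submodule R M)) : x = 0 := by
  by_contra hx
  have hne : Ideal.torsionOf R M x ≠ ⊤ := by
    rwa [Ne, Ideal.torsionOf_eq_top_iff]
  obtain ⟨P, hP, hle⟩ := Ideal.exists_le_maximal _ hne
  obtain ⟨r, hr⟩ := (P.mem_iInf_smul_pow_eq_bot_iff x).mp ((Submodule.mem_iInf _).mpr (h P hP))
  have hmem : 1 - (r : R) ∈ P := hle <| by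
    rw [Ideal.mem_torsionOf_iff, sub_smul, one_smul, hr, sub_self]
  exact hP.ne_top ((Ideal.eq_top_iff_one P).mpr (by simpa using P.add_mem hmem r.2))

/-- A maximal ideal of `ℤ` is generated by a prime number. -/
theorem Int.exists_prime_span_eq_of_isMaximal (P : Ideal ℤ) (hP : P.IsMaximal) :
    ∃ p : ℕ, p.Prime ∧ P = Ideal.span {(p : ℤ)} := by
  have hbot : P ≠ ⊥ := Ring.ne_bot_of_isMaximal_of_not_isField hP Int.not_isField
  have hgen := Ideal.span_singleton_generator P
  have hprime := Submodule.IsPrincipal.prime_generator_of_isPrime P hbot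
  refine ⟨(Submodule.IsPrincipal.generator P).natAbs, Int.prime_iff_natAbs_prime.mp hprime, ?_⟩
  rw [Int.span_natAbs, hgen]

/-- Let `s 1, …, s m ∈ ℤ^n` be the rows of an integer matrix and let `u ∈ ℤ^n`.
If for every prime power `q`, the reduction of `u` modulo `q` is a `ℤ/qℤ`-linear
combination of the reductions of the `s i`, then `u` is an integer linear
combination of the `s i`. -/
theorem mem_int_span_of_mem_span_all_prime_powers {m n : ℕ}
    (s : Fin m → Fin n → ℤ) (u : Fin n → ℤ)
    (h : ∀ q : ℕ, IsPrimePow q → ∃ α : Fin m → ZMod q,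
      ∀ j, ((u j : ℤ) : ZMod q) = ∑ i, α i * ((s i j : ℤ) : ZMod q)) :
    ∃ α : Fin m → ℤ, ∀ j, u j = ∑ i, α i * s i j := by
  set N := Submodule.span ℤ (Set.range s) with hN
  suffices hu : N.mkQ u = 0 by
    rw [Submodule.mkQ_apply, Submodule.Quotient.mk_eq_zero, hN,
      Submodule.mem_span_range_iff_exists_fun] at hu
    obtain ⟨α, hα⟩ := hu
    exact ⟨α, fun j => by simp [← hα]⟩
  refine eq_zero_of_forall_mem_maximal_pow_smul_top (R := ℤ) _ fun P hP k => ?_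
  obtain ⟨p, hp, rfl⟩ := Int.exists_prime_span_eq_of_isMaximal P hP
  rcases Nat.eq_zero_or_pos k with rfl | hk
  · simp
  obtain ⟨α, hα⟩ := h (p ^ k) (hp.isPrimePow.pow hk.ne')
  choose β hβ using fun i => ZMod.intCast_surjective (α i)
  have hdvd (j : Fin n) : ((p : ℤ) ^ k) ∣ u j - ∑ i, β i * s i j := by
    have := (ZMod.intCast_zmod_eq_zero_iff_dvd (u j - ∑ i, β i * s i j) (p ^ k)).mp
      (by simp [hβ, hα])
    exact_mod_cast this
  choose v hv using hdvd
  have hu : u = ∑ i, β i • s i + ((p : ℤ) ^ k) • v := by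
    ext j
    simp [← hv]
  have hker : N.mkQ (∑ i, β i • s i) = 0 := (Submodule.Quotient.mk_eq_zero N).mpr <|
    Submodule.sum_mem _ fun i _ => N.smul_mem _ (Submodule.subset_span ⟨i, rfl⟩)
  rw [hu, map_add, hker, zero_add, map_smul]
  exact Submodule.smul_mem_smul
    (Ideal.pow_mem_pow (Ideal.mem_span_singleton_self _) k) Submodule.mem_top
end

section
/- Let q be a prime power and let A be an m × n matrix over ℤ/qℤ with rows a_1,…,a_m. Suppose there exists no constant c ≢ 0 (mod q) for which the system Ax ≡ b (mod q) has a solution x, where b = (0,…,0,c)^T is the column vector with c in the last position and zeros elsewhere. Then a_m ∈ span_q({a_1,…,a_{m−1}}). -/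
open scoped Matrix

/-- For an integer `z`, the class of `z / q` in `ℚ/ℤ` vanishes iff `z` vanishes modulo `q`. -/
theorem AddCircle.coe_intCast_div_eq_zero_iff (q : ℕ) [NeZero q] (z : ℤ) :
    (((z : ℚ) / q : ℚ) : AddCircle (1 : ℚ)) = 0 ↔ (z : ZMod q) = 0 := by
  have hq : (q : ℚ) ≠ 0 := NeZero.ne _
  rw [AddCircle.coe_eq_zero_iff, ZMod.intCast_zmod_eq_zero_iff_dvd]
  constructor
  · rintro ⟨n, hn⟩
    refine ⟨n, ?_⟩
    rw [zsmul_eq_mul, mul_one, eq_div_iff hq] at hn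
    rw [mul_comm]
    exact_mod_cast hn.symm
  · rintro ⟨n, rfl⟩
    refine ⟨n, ?_⟩
    push_cast
    field_simp
    simp

/-- An element of `ℚ/ℤ` killed by `q` is of the form `z / q`. -/
theorem AddCircle.exists_coe_intCast_div_of_nsmul_eq_zero (q : ℕ) [NeZero q]
    {y : AddCircle (1 : ℚ)} (hy : q • y = 0) :
    ∃ z : ℤ, y = (((z : ℚ) / q : ℚ) : AddCircle (1 : ℚ)) := by
  have hq : (q : ℚ) ≠ 0 := NeZero.ne _
  obtain ⟨r, rfl⟩ := QuotientAddGroup.mk_surjective y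
  obtain ⟨z, hz⟩ := (AddCircle.coe_eq_zero_iff (1 : ℚ) (x := q • r)).1 hy
  refine ⟨z, ?_⟩
  rw [zsmul_eq_mul, mul_one, nsmul_eq_mul] at hz
  rw [hz, mul_div_cancel_left₀ _ hq]

/-- A vector over `ℤ/qℤ` outside a submodule is separated from it by a linear form. -/
theorem ZMod.exists_dotProduct_ne_zero_of_notMem {ι : Type*} [Fintype ι] {q : ℕ} [NeZero q]
    {N : Submodule (ZMod q) (ι → ZMod q)} {a : ι → ZMod q} (ha : a ∉ N) :
    ∃ x : ι → ZMod q, (∀ v ∈ N, v ⬝ᵥ x = 0) ∧ a ⬝ᵥ x ≠ 0 := by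
  classical
  obtain ⟨c, hc⟩ := CharacterModule.exists_character_apply_ne_zero_of_ne_zero
    (mt (Submodule.Quotient.mk_eq_zero N).1 ha)
  let f : (ι → ZMod q) →+ AddCircle (1 : ℚ) :=
    AddMonoidHom.comp (c : _ →+ AddCircle (1 : ℚ)) N.mkQ.toAddMonoidHom
  have hf (j : ι) : q • f (Pi.single j 1) = 0 := by
    rw [← map_nsmul, ← Nat.cast_smul_eq_nsmul (ZMod q)]
    simp
  choose k hk using fun j => AddCircle.exists_coe_intCast_div_of_nsmul_eq_zero q (hf j)
  have key (v : ι → ZMod q) : f v = 0 ↔ v ⬝ᵥ (fun j => (k j : ZMod q)) = 0 := by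
    have hv : v = ∑ j, (v j).val • Pi.single j (1 : ZMod q) := by
      conv_lhs => rw [pi_eq_sum_univ' v]
      refine Finset.sum_congr rfl fun j _ => ?_
      rw [← Nat.cast_smul_eq_nsmul (ZMod q), ZMod.natCast_zmod_val]
    have hfv : f v = (((∑ j, ((v j).val : ℤ) * k j : ℤ) : ℚ) / q : ℚ) := by
      conv_lhs => rw [hv]
      simp only [map_sum, map_nsmul, hk, ← AddCircle.coe_nsmul]
      rw [Int.cast_sum, Finset.sum_div]
      refine Eq.trans ?_ (map_sum (QuotientAddGroup.mk' (AddSubgroup.zmultiples (1 : ℚ))) _ _).symm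
      refine Finset.sum_congr rfl fun j _ => ?_
      simp [mul_div_assoc]
    rw [hfv, AddCircle.coe_intCast_div_eq_zero_iff]
    simp [dotProduct]
  refine ⟨fun j => (k j : ZMod q), fun v hv => (key v).1 ?_, fun h0 => hc ((key a).2 h0)⟩
  change c (Submodule.Quotient.mk v) = 0
  rw [(Submodule.Quotient.mk_eq_zero N).2 hv, map_zero]

/-- Let `q` be a prime power and let `A` be an `(m+1) × n` matrix over `ℤ/qℤ`.
If there is no constant `c ≢ 0 (mod q)` for which the system `A x = (0, …, 0, c)ᵀ`
has a solution `x`, then the last row of `A` lies in the span of the other rows. -/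
theorem lastRow_mem_span_of_no_solution {m n : ℕ} (q : ℕ) (hq : IsPrimePow q)
    (A : Matrix (Fin (m + 1)) (Fin n) (ZMod q))
    (h : ¬ ∃ c : ZMod q, c ≠ 0 ∧ ∃ x : Fin n → ZMod q,
      A.mulVec x = fun i => if i = Fin.last m then c else 0) :
    ∃ β : Fin m → ZMod q, ∀ j, A (Fin.last m) j = ∑ i, β i * A i.castSucc j := by
  have : NeZero q := ⟨hq.ne_zero⟩
  have hmem : A (Fin.last m) ∈
      Submodule.span (ZMod q) (Set.range fun i : Fin m => A i.castSucc) := by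
    by_contra ha
    obtain ⟨x, hx, hax⟩ := ZMod.exists_dotProduct_ne_zero_of_notMem ha
    refine h ⟨_, hax, x, funext fun i => ?_⟩
    induction i using Fin.lastCases with
    | last => simp [Matrix.mulVec]
    | cast i =>
      simpa [Matrix.mulVec, (Fin.castSucc_lt_last i).ne] using
        hx _ (Submodule.subset_span ⟨i, rfl⟩)
  obtain ⟨β, hβ⟩ := (Submodule.mem_span_range_iff_exists_fun _).1 hmem
  exact ⟨β, fun j => by simp [← hβ]⟩
end

section
/- Let R ⊆ {0,1}^k be a Boolean relation that is not balanced. Then there exists a tuple u ∈ {0,1}^k \ R such that for every ring E there is no polynomial p(x_1,…,x_k) = β_0 + β_1 x_1 + ⋯ + β_k x_k of degree at most 1 with coefficients in E that captures u with respect to R. -/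
/-- If `coeffOp α` is defined at `x`, its value is the weighted sum of the entries of `x`. -/
lemma coeffOp_eq_some {m : ℕ} {α : Fin m → ℤ} {x : Fin m → Bool} {b : Bool}
    (h : coeffOp α x = some b) : ∑ i, α i * bInt (x i) = bInt b := by
  unfold coeffOp at h
  split_ifs at h with h1 h0
  · obtain rfl : true = b := by simpa using h
    simpa [bInt] using h1
  · obtain rfl : false = b := by simpa using h
    simpa [bInt] using h0

lemma cast_bInt {E : Type*} [Ring E] (b : Bool) :
    ((bInt b : ℤ) : E) = if b then 1 else 0 := by
  cases b <;> simp [bInt]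

/-- An affine polynomial commutes with integer combinations whose coefficients sum to `1`. -/
lemma affine_eval_of_sum_eq {E : Type*} [Ring E] {m k : ℕ} {α : Fin m → ℤ}
    (hα : ∑ i, α i = 1) {t : Fin m → Fin k → Bool} {w : Fin k → Bool}
    (hw : ∀ j, ∑ i, α i * bInt (t i j) = bInt (w j)) (β₀ : E) (β : Fin k → E) :
    β₀ + ∑ j, β j * (if w j then (1 : E) else 0) =
      ∑ i, α i • (β₀ + ∑ j, β j * (if t i j then (1 : E) else 0)) := by
  simp only [← cast_bInt, ← hw, smul_add, Finset.sum_add_distrib, ← Finset.sum_smul, hα,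
    one_smul, Finset.smul_sum]
  rw [Finset.sum_comm]
  congr 1
  refine Finset.sum_congr rfl fun j _ => ?_
  push_cast
  rw [Finset.mul_sum]
  refine Finset.sum_congr rfl fun i _ => ?_
  rw [zsmul_eq_mul, ← mul_assoc, ← mul_assoc, (Int.cast_commute (α i) (β j)).eq]

/-- Let `R ⊆ {0,1}^k` be a Boolean relation that is not balanced. Then there is a tuple
`u ∈ {0,1}^k \ R` such that for every ring `E`, no degree-`≤ 1` polynomial
`β₀ + β₁ x₁ + ⋯ + β_k x_k` with coefficients in `E` captures `u` with respect to `R`. -/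
theorem not_balanced_implies_no_linear_polynomial {k : ℕ} (R : Set (Fin k → Bool))
    (hR : ¬ IsBalancedRel R) :
    ∃ u : Fin k → Bool, u ∉ R ∧
      ∀ (E : Type) [Ring E], ∀ (β₀ : E) (β : Fin k → E),
        ¬ ((∀ x ∈ R, β₀ + ∑ i, β i * (if x i then 1 else 0) = 0) ∧
            β₀ + ∑ i, β i * (if u i then (1 : E) else 0) ≠ 0) := by
  simp only [IsBalancedRel, Preserves, not_forall] at hR
  obtain ⟨m, _, ⟨α, hα, rfl⟩, t, ht, u, hu, huR⟩ := hR
  refine ⟨u, huR, fun E _ β₀ β ⟨hzero, hne⟩ => hne ?_⟩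
  rw [affine_eval_of_sum_eq hα (fun j => coeffOp_eq_some (hu j))]
  exact Finset.sum_eq_zero fun i _ => by rw [hzero _ (ht i), smul_zero]
end

section
/- Let R ⊆ {0,1}^k be a symmetric Boolean relation with set of satisfying weights S ⊆ {0,1,…,k}, and let U = {0,1,…,k} \ S. If there exist a, b, c ∈ S and d ∈ U such that a − b + c = d, then the relation 2-OR is cone-definable from R. -/
/-- An entry of a cone-definition tuple: a constant `0`/`1`, a variable `x i`,
or a negated variable `¬ x i`. -/
inductive ConeEntry (m : ℕ) where
  | const : Bool → ConeEntry m
  | pos : Fin m → ConeEntry m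
  | neg : Fin m → ConeEntry m

/-- Evaluate a cone entry under an assignment `f` to the variables. -/
def ConeEntry.eval {m : ℕ} (f : Fin m → Bool) : ConeEntry m → Bool
  | .const b => b
  | .pos i => f i
  | .neg i => !(f i)

/-- A Boolean relation `T` of arity `m` is cone-definable from a Boolean relation `U` of
arity `n` if there is a tuple `(y_1, …, y_n)` of constants, variables and negated
variables, in which every variable `x_1, …, x_m` occurs, such that for every assignment
`f` we have `(f x_1, …, f x_m) ∈ T` iff the evaluation of `(y_1, …, y_n)` lies in `U`. -/
def ConeDefinable {m n : ℕ} (T : Set (Fin m → Bool)) (U : Set (Fin n → Bool)) : Prop :=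
  ∃ y : Fin n → ConeEntry m,
    (∀ i : Fin m, ∃ j : Fin n, y j = ConeEntry.pos i ∨ y j = ConeEntry.neg i) ∧
    (∀ f : Fin m → Bool, f ∈ T ↔ (fun j => (y j).eval f) ∈ U)

/-- The `k`-ary OR relation: all tuples except the all-zeros tuple. -/
def kOR (k : ℕ) : Set (Fin k → Bool) := {x | ∃ i, x i = true}

/-- The weight (number of `1` entries) of a Boolean tuple. -/
def wt {k : ℕ} (x : Fin k → Bool) : ℕ := ∑ i, if x i then 1 else 0

/-- The weight of a tuple made of consecutive blocks: `q` ones, `r` copies of `u`, `s` copies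
of `v`, and zeros up to length `k`. -/
theorem wt_blocks {k q r s : ℕ} (h : q + r + s ≤ k) (u v : Bool) :
    wt (fun j : Fin k => if j.val < q then true else if j.val < q + r then u
      else if j.val < q + r + s then v else false)
      = q + (if u then r else 0) + (if v then s else 0) := by
  obtain ⟨t, rfl⟩ := Nat.exists_eq_add_of_le h
  unfold wt
  rw [Fin.sum_univ_eq_sum_range (fun j => if (if j < q then true else if j < q + r then u
      else if j < q + r + s then v else false) = true then 1 else 0) (q + r + s + t),
    Finset.sum_range_add, Finset.sum_range_add, Finset.sum_range_add]
  rw [Finset.sum_const_nat (m := 1), Finset.sum_const_nat (m := if u then 1 else 0),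
    Finset.sum_const_nat (m := if v then 1 else 0), Finset.sum_const_nat (m := 0)]
  · simp
  all_goals
    intro x hx
    have := Finset.mem_range.mp hx
    grind

/-- The variable `x i`, negated when `σ` is true. -/
def ConeEntry.literal {m : ℕ} (σ : Bool) (i : Fin m) : ConeEntry m :=
  if σ then .neg i else .pos i

theorem ConeEntry.eval_literal {m : ℕ} (f : Fin m → Bool) (σ : Bool) (i : Fin m) :
    (ConeEntry.literal σ i).eval f = (σ ^^ f i) := by
  cases σ <;> simp [ConeEntry.literal, ConeEntry.eval]

theorem ConeEntry.literal_eq_pos_or_neg {m : ℕ} (σ : Bool) (i : Fin m) :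
    ConeEntry.literal σ i = .pos i ∨ ConeEntry.literal σ i = .neg i := by
  cases σ <;> simp [ConeEntry.literal]

/-- A symmetric relation cone-defines `2`-OR as soon as some tuple with `q` ones, `r` copies of
one literal and `s` copies of another one has the right weights. -/
theorem coneDefinable_twoOR_of_blocks {k : ℕ} {R : Set (Fin k → Bool)} {S : Set ℕ}
    (hsym : ∀ x : Fin k → Bool, x ∈ R ↔ wt x ∈ S) {q r s : ℕ} (σ τ : Bool)
    (hr : 0 < r) (hs : 0 < s) (hk : q + r + s ≤ k)
    (hS : ∀ u v : Bool, (u = true ∨ v = true) ↔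
      q + (if σ ^^ u then r else 0) + (if τ ^^ v then s else 0) ∈ S) :
    ConeDefinable (kOR 2) R := by
  refine ⟨fun j => if j.val < q then .const true else if j.val < q + r then .literal σ 0
      else if j.val < q + r + s then .literal τ 1 else .const false, ?_, fun f => ?_⟩
  · rw [Fin.forall_fin_two]
    refine ⟨⟨⟨q, by omega⟩, ?_⟩, ⟨⟨q + r, by omega⟩, ?_⟩⟩
    · simpa [hr] using ConeEntry.literal_eq_pos_or_neg σ 0
    · simpa [hs] using ConeEntry.literal_eq_pos_or_neg τ 1
  · rw [hsym]
    simp only [apply_ite (ConeEntry.eval f), ConeEntry.eval_literal]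
    simp only [ConeEntry.eval]
    rw [wt_blocks hk, ← hS (f 0) (f 1)]
    exact Fin.exists_fin_two

/-- Let `R ⊆ {0,1}^k` be a symmetric Boolean relation with set of satisfying weights
`S ⊆ {0, 1, …, k}`. If there are `a, b, c ∈ S` and `d ∈ {0, …, k} \ S` with
`a - b + c = d`, then the `2`-OR relation is cone-definable from `R`. -/
theorem symmetric_coneDefines_twoOR_of_sum {k : ℕ} (R : Set (Fin k → Bool)) (S : Set ℕ)
    (hSk : ∀ s ∈ S, s ≤ k)
    (hsym : ∀ x : Fin k → Bool, x ∈ R ↔ wt x ∈ S)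
    (a b c d : ℕ) (ha : a ∈ S) (hb : b ∈ S) (hc : c ∈ S)
    (hdk : d ≤ k) (hdS : d ∉ S)
    (habcd : (a : ℤ) - (b : ℤ) + (c : ℤ) = (d : ℤ)) :
    ConeDefinable (kOR 2) R := by
  have hak := hSk a ha
  have hbk := hSk b hb
  have hck := hSk c hc
  have hbc : b ≠ c := by
    rintro rfl
    exact hdS ((show d = a by omega) ▸ ha)
  have hba : b ≠ a := by
    rintro rfl
    exact hdS ((show d = c by omega) ▸ hc)
  have key : ∀ q r s : ℕ, ∀ σ τ : Bool, 0 < r → 0 < s → q + r + s ≤ k →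
      q + (if σ then r else 0) + (if τ then s else 0) = d →
      q + (if !σ then r else 0) + (if τ then s else 0) = a →
      q + (if σ then r else 0) + (if !τ then s else 0) = c →
      q + (if !σ then r else 0) + (if !τ then s else 0) = b → ConeDefinable (kOR 2) R := by
    intro q r s σ τ hr hs hk h₀₀ h₁₀ h₀₁ h₁₁
    refine coneDefinable_twoOR_of_blocks hsym σ τ hr hs hk fun u v => ?_
    cases u <;> cases v <;> simp only [Bool.xor_false, Bool.xor_true, h₀₀, h₁₀, h₀₁, h₁₁] <;>
      simp [ha, hb, hc, hdS]
  rcases hbc.lt_or_gt with h | h <;> rcases hba.lt_or_gt with h' | h'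
  · apply key b (c - b) (a - b) true true <;> grind
  · apply key a (c - b) (b - a) true false <;> grind
  · apply key c (b - c) (a - b) false true <;> grind
  · apply key d (b - c) (b - a) false false <;> grind
end

section
/- Let k ∈ ℕ, let S ⊆ {0,1,…,k} and let U = {0,1,…,k} \ S. Let m ≥ 3 be odd, let s_1,…,s_m ∈ S and t ∈ U satisfy the alternating sum s_1 − s_2 + s_3 − s_4 + ⋯ + s_m = t. Then there exist distinct indices i, j, ℓ ∈ {1,…,m} with i and j odd and ℓ even such that s_i − s_ℓ + s_j ∈ {0,1,…,k}. -/
/-- If `f` takes values in `[0, k]` and no sum `f i - f l + f j` with `i ≠ j` even and `l` odd,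
all at most `2 * n + 2`, lies in `[0, k]`, then the last three consecutive terms and the whole
alternating sum both lie on the same side of `[0, k]`. -/
theorem alternating_sum_outside_of_triples_outside (k : ℤ) (f : ℕ → ℤ)
    (hf : ∀ i, 0 ≤ f i ∧ f i ≤ k) (n : ℕ)
    (h : ∀ i j l, i ≠ j → Even i → Even j → Odd l → i ≤ 2 * n + 2 → j ≤ 2 * n + 2 →
      l ≤ 2 * n + 2 → f i - f l + f j < 0 ∨ k < f i - f l + f j) :
    (f (2 * n) - f (2 * n + 1) + f (2 * n + 2) < 0 ∧
      ∑ i ∈ Finset.range (2 * n + 3), (-1 : ℤ) ^ i * f i < 0) ∨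
    (k < f (2 * n) - f (2 * n + 1) + f (2 * n + 2) ∧
      k < ∑ i ∈ Finset.range (2 * n + 3), (-1 : ℤ) ^ i * f i) := by
  induction n with
  | zero =>
    have h₀ := h 0 2 1 (by decide) (by decide) (by decide) (by decide) (by simp) (by simp) (by simp)
    simp [Finset.sum_range_succ] at h₀ ⊢
    omega
  | succ n ih =>
    have ih := ih fun i j l hij hi hj hl hi' hj' hl' ↦
      h i j l hij hi hj hl (by omega) (by omega) (by omega)
    have hprev := h (2 * n) (2 * n + 2) (2 * n + 3) (by omega) (by grind) (by grind) (by grind)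
      (by omega) (by omega) (by omega)
    have hlast := h (2 * n + 2) (2 * n + 4) (2 * n + 3) (by omega) (by grind) (by grind) (by grind)
      (by omega) (by omega) (by omega)
    have hsum : ∑ i ∈ Finset.range (2 * (n + 1) + 3), (-1 : ℤ) ^ i * f i =
        ∑ i ∈ Finset.range (2 * n + 3), (-1 : ℤ) ^ i * f i - f (2 * n + 3) + f (2 * n + 4) := by
      rw [show 2 * (n + 1) + 3 = 2 * n + 3 + 1 + 1 by ring, Finset.sum_range_succ,
        Finset.sum_range_succ, Odd.neg_one_pow (by grind), Even.neg_one_pow (by grind)]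
      ring
    rw [hsum]
    simp only [show 2 * (n + 1) = 2 * n + 2 by ring, add_assoc, Nat.reduceAdd]
    have h₀ := hf (2 * n)
    have h₁ := hf (2 * n + 1)
    have h₂ := hf (2 * n + 2)
    have h₃ := hf (2 * n + 3)
    have h₄ := hf (2 * n + 4)
    omega


/-- Let `S ⊆ {0, …, k}` and `U = {0, …, k} \ S`. Let `m ≥ 3` be odd, let
`s 1, …, s m ∈ S` and `t ∈ U` satisfy the alternating sum
`s 1 - s 2 + s 3 - ⋯ + s m = t`. Then there are distinct indices `i, j, ℓ` with `i, j`
at odd positions and `ℓ` at an even position (positions counted from `1`; with `Fin m`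
indexing from `0`, this means `(i : ℕ)` and `(j : ℕ)` even and `(ℓ : ℕ)` odd) such that
`s i - s ℓ + s j ∈ {0, …, k}`. -/
theorem exists_short_alternating_sum (k : ℕ) (S : Set ℕ) (hSk : ∀ x ∈ S, x ≤ k)
    (m : ℕ) (hm3 : 3 ≤ m) (hmodd : Odd m)
    (s : Fin m → ℕ) (hs : ∀ i, s i ∈ S)
    (t : ℕ) (htk : t ≤ k) (htS : t ∉ S)
    (hsum : ∑ i : Fin m, (-1 : ℤ) ^ (i : ℕ) * (s i : ℤ) = (t : ℤ)) :
    ∃ i j ℓ : Fin m, i ≠ j ∧ i ≠ ℓ ∧ j ≠ ℓ ∧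
      Even (i : ℕ) ∧ Even (j : ℕ) ∧ Odd (ℓ : ℕ) ∧
      0 ≤ (s i : ℤ) - (s ℓ : ℤ) + (s j : ℤ) ∧
      (s i : ℤ) - (s ℓ : ℤ) + (s j : ℤ) ≤ (k : ℤ) := by
  obtain ⟨n, rfl⟩ : ∃ n, m = 2 * n + 3 := by
    obtain ⟨r, rfl⟩ := hmodd
    exact ⟨r - 1, by omega⟩
  by_contra! hcon
  let f : ℕ → ℤ := fun i ↦ if hi : i < 2 * n + 3 then (s ⟨i, hi⟩ : ℤ) else 0
  have hf_val (i : Fin (2 * n + 3)) : f i = s i := by simp [f]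
  have hf (i : ℕ) : 0 ≤ f i ∧ f i ≤ k := by
    by_cases hi : i < 2 * n + 3
    · have := hSk _ (hs ⟨i, hi⟩)
      simp only [f, dif_pos hi]
      omega
    · simp [f, hi]
  have hout := alternating_sum_outside_of_triples_outside k f hf n
    fun i j l hij hi hj hl hi' hj' hl' ↦ by
      have := hcon ⟨i, by omega⟩ ⟨j, by omega⟩ ⟨l, by omega⟩ (by simpa using hij)
        (by simp only [ne_eq, Fin.mk.injEq]; grind)
        (by simp only [ne_eq, Fin.mk.injEq]; grind) hi hj hl
      simp only [← hf_val] at this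
      omega
  rw [Finset.sum_range] at hout
  simp only [hf_val, hsum] at hout
  omega
end

section
/- A Boolean relation R ⊆ {0,1}^2 of arity 2 is balanced if and only if it is not cone-interdefinable with the relation 2-OR. -/
theorem coeffOp_eq_some_iff {m : ℕ} (α : Fin m → ℤ) (x : Fin m → Bool) (b : Bool) :
    coeffOp α x = some b ↔ ∑ i, α i * bInt (x i) = bInt b := by
  unfold coeffOp
  cases b <;> split_ifs <;> simp_all [bInt]

/-- An `n`-ary relation cone-definable from `kOR n` misses exactly one tuple. -/
theorem ConeDefinable.eq_compl_singleton {n : ℕ} {R : Set (Fin n → Bool)}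
    (h : ConeDefinable R (kOR n)) : ∃ c, R = {c}ᶜ := by
  obtain ⟨y, hy, hR⟩ := h
  choose σ hσ using hy
  have hinj : Function.Injective σ := by
    intro i i' hii
    have h₁ := hσ i
    have h₂ := hσ i'
    rw [hii] at h₁
    rcases h₁ with h₁ | h₁ <;> rcases h₂ with h₂ | h₂ <;> simp_all
  have hsurj : Function.Surjective σ := Finite.surjective_of_injective hinj
  have hc : ∀ i, ∃ b : Bool, ∀ f, (y (σ i)).eval f = true ↔ f i ≠ b := by
    intro i
    rcases hσ i with h | h <;> rw [h]
    · exact ⟨false, fun f => by simp [ConeEntry.eval]⟩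
    · exact ⟨true, fun f => by simp [ConeEntry.eval]⟩
  choose c hc using hc
  refine ⟨c, Set.ext fun f => ?_⟩
  rw [hR, Set.mem_compl_singleton_iff, Function.ne_iff, kOR, Set.mem_ofPred_eq, hsurj.exists]
  simp only [hc]

/-- The literal of `x i` that is true exactly when `x i` differs from `b`. -/
def literalNe {n : ℕ} (b : Bool) (i : Fin n) : ConeEntry n :=
  if b then .neg i else .pos i

theorem eval_literalNe {n : ℕ} (b : Bool) (i : Fin n) (f : Fin n → Bool) :
    (literalNe b i).eval f = xor b (f i) := by
  cases b <;> simp [literalNe, ConeEntry.eval]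

theorem literalNe_eq_pos_or_neg {n : ℕ} (b : Bool) (i : Fin n) :
    literalNe b i = .pos i ∨ literalNe b i = .neg i := by
  cases b <;> simp [literalNe]

theorem coneDefinable_compl_singleton_kOR {n : ℕ} (c : Fin n → Bool) :
    ConeDefinable {c}ᶜ (kOR n) := by
  refine ⟨fun i => literalNe (c i) i, fun i => ⟨i, literalNe_eq_pos_or_neg _ i⟩, fun f => ?_⟩
  simp only [Set.mem_compl_singleton_iff, Function.ne_iff, kOR, Set.mem_ofPred_eq, eval_literalNe,
    bne_iff_ne, ne_comm]

theorem coneDefinable_kOR_compl_singleton {n : ℕ} (c : Fin n → Bool) :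
    ConeDefinable (kOR n) {c}ᶜ := by
  refine ⟨fun i => literalNe (c i) i, fun i => ⟨i, literalNe_eq_pos_or_neg _ i⟩, fun f => ?_⟩
  simp only [Set.mem_compl_singleton_iff, Function.ne_iff, kOR, Set.mem_ofPred_eq, eval_literalNe]
  refine exists_congr fun i => ?_
  cases c i <;> cases f i <;> simp

theorem not_isBalancedRel_compl_singleton (c : Fin 2 → Bool) :
    ¬ IsBalancedRel ({c}ᶜ : Set (Fin 2 → Bool)) := by
  intro h
  refine h 3 (coeffOp ![1, 1, -1]) ⟨_, by simp [Fin.sum_univ_three], rfl⟩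
    ![![c 0, !c 1], ![!c 0, c 1], ![!c 0, !c 1]] ?_ c ?_ rfl
  · intro i
    fin_cases i <;> simp [funext_iff, Fin.forall_fin_two]
  · intro j
    rw [coeffOp_eq_some_iff]
    fin_cases j <;> simp [Fin.sum_univ_three]

/-- Balanced operations preserve affine equations. -/
theorem affine_eq_of_coeffOp {m n : ℕ} {α : Fin m → ℤ} (hα : ∑ i, α i = 1)
    {t : Fin m → Fin n → Bool} {w : Fin n → Bool}
    (hw : ∀ j, coeffOp α (fun i => t i j) = some (w j)) {a : Fin n → ℤ} {b : ℤ}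
    (ht : ∀ i, ∑ j, a j * bInt (t i j) = b) : ∑ j, a j * bInt (w j) = b := by
  simp only [coeffOp_eq_some_iff] at hw
  calc ∑ j, a j * bInt (w j) = ∑ i, α i * ∑ j, a j * bInt (t i j) := by
        simp only [← hw, Finset.mul_sum]
        rw [Finset.sum_comm]
        exact Finset.sum_congr rfl fun i _ => Finset.sum_congr rfl fun j _ => by ring
    _ = b := by simp only [ht, ← Finset.sum_mul, hα, one_mul]

/-- Some affine equation holds at all Boolean pairs other than `v` and `w`, but fails at `w`. -/
theorem exists_affine_separating {v w : Fin 2 → Bool} (hvw : v ≠ w) :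
    ∃ (a : Fin 2 → ℤ) (b : ℤ), (∀ x, x ≠ v → x ≠ w → ∑ j, a j * bInt (x j) = b) ∧
      ∑ j, a j * bInt (w j) ≠ b := by
  simp only [Function.ne_iff, Fin.exists_fin_two, Fin.sum_univ_two] at hvw ⊢
  by_cases h₀ : v 0 = w 0
  · refine ⟨![1, 0], bInt (!w 0), fun x => ?_, ?_⟩
    · cases hw₀ : w 0 <;> cases hw₁ : w 1 <;> cases hx₀ : x 0 <;> cases hx₁ : x 1 <;>
        simp_all [bInt]
    · cases w 0 <;> simp [bInt]
  by_cases h₁ : v 1 = w 1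
  · refine ⟨![0, 1], bInt (!w 1), fun x => ?_, ?_⟩
    · cases hw₀ : w 0 <;> cases hw₁ : w 1 <;> cases hx₀ : x 0 <;> cases hx₁ : x 1 <;>
        simp_all [bInt]
    · cases w 1 <;> simp [bInt]
  refine ⟨![1 - 2 * bInt (w 0), 1 - 2 * bInt (w 1)], 1 - bInt (w 0) - bInt (w 1),
    fun x => ?_, ?_⟩
  · cases hw₀ : w 0 <;> cases hw₁ : w 1 <;> cases hx₀ : x 0 <;> cases hx₁ : x 1 <;>
      simp_all [bInt]
  · cases hw₀ : w 0 <;> cases hw₁ : w 1 <;> simp [bInt]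

theorem eq_compl_singleton_of_not_isBalancedRel {R : Set (Fin 2 → Bool)}
    (h : ¬ IsBalancedRel R) : ∃ c, R = {c}ᶜ := by
  simp only [IsBalancedRel, Preserves, not_forall] at h
  obtain ⟨m, f, ⟨α, hα, rfl⟩, t, ht, w, hw, hwR⟩ := h
  refine ⟨w, Set.Subset.antisymm (fun x hx hxw => hwR (hxw ▸ hx)) fun v hvw => ?_⟩
  by_contra hvR
  obtain ⟨a, b, hab, hne⟩ := exists_affine_separating hvw
  exact hne (affine_eq_of_coeffOp hα hw fun i => hab _
    (fun h => hvR (h ▸ ht i)) fun h => hwR (h ▸ ht i))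

/-- A Boolean relation of arity `2` is balanced if and only if it is not
cone-interdefinable with the `2`-OR relation. -/
theorem arity_two_balanced_iff_not_coneInterdefinable_twoOR (R : Set (Fin 2 → Bool)) :
    IsBalancedRel R ↔ ¬ (ConeDefinable R (kOR 2) ∧ ConeDefinable (kOR 2) R) := by
  constructor
  · rintro hR ⟨h, -⟩
    obtain ⟨c, rfl⟩ := h.eq_compl_singleton
    exact not_isBalancedRel_compl_singleton c hR
  · contrapose!
    intro h
    obtain ⟨c, rfl⟩ := eq_compl_singleton_of_not_isBalancedRel h
    exact ⟨coneDefinable_compl_singleton_kOR c, coneDefinable_kOR_compl_singleton c⟩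
end

section
/- Let U ⊆ {0,1}^3 be a Boolean relation of arity 3 that is not balanced. Then the relation 2-OR is cone-definable from U. -/
/-- If exactly three corners of a two-dimensional square `w, w ⊕ a, w ⊕ b, w ⊕ a ⊕ b` with
`a`, `b` nonzero and disjoint lie in `U`, then `U` cone-defines `2`-OR. -/
lemma coneDefinable_twoOR_of_square {n : ℕ} {U : Set (Fin n → Bool)} (w a b : Fin n → Bool)
    (ha : ∃ j, a j = true) (hb : ∃ j, b j = true) (hab : ∀ j, (a j && b j) = false)
    (hw : w ∉ U) (hwa : (fun j => w j ^^ a j) ∈ U) (hwb : (fun j => w j ^^ b j) ∈ U)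
    (hwab : (fun j => w j ^^ a j ^^ b j) ∈ U) :
    ConeDefinable (kOR 2) U := by
  let entry (i : Fin 2) (s : Bool) : ConeEntry 2 := if s then .neg i else .pos i
  let y : Fin n → ConeEntry 2 := fun j =>
    if a j then entry 0 (w j) else if b j then entry 1 (w j) else .const (w j)
  have hy (f : Fin 2 → Bool) :
      (fun j => (y j).eval f) = fun j => w j ^^ (f 0 && a j) ^^ (f 1 && b j) := by
    funext j
    have := hab j
    cases h₁ : a j <;> cases h₂ : b j <;> cases h₃ : w j <;>
      simp_all [y, entry, ConeEntry.eval]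
  refine ⟨y, fun i => ?_, fun f => ?_⟩
  · obtain ⟨j, hj⟩ := ha
    obtain ⟨k, hk⟩ := hb
    have hk' : a k = false := by simpa [hk] using hab k
    fin_cases i
    · exact ⟨j, by cases h : w j <;> simp [y, entry, hj, h]⟩
    · exact ⟨k, by cases h : w k <;> simp [y, entry, hk, hk', h]⟩
  · rw [hy]
    simp only [Bool.xor_assoc] at hwab
    cases h₀ : f 0 <;> cases h₁ : f 1 <;>
      simp [kOR, Fin.exists_fin_two, h₀, h₁, hw, hwa, hwb, hwab]

/-- An affine congruence satisfied by all arguments of a balanced operation is satisfied by its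
result. -/
lemma coeffOp_affine_dvd {m n : ℕ} {α : Fin m → ℤ} (hα : ∑ i, α i = 1)
    {t : Fin m → Fin n → Bool} {w : Fin n → Bool}
    (hw : ∀ j, coeffOp α (fun i => t i j) = some (w j)) (c : Fin n → ℤ) (d q : ℤ)
    (ht : ∀ i, q ∣ ∑ j, c j * bInt (t i j) + d) : q ∣ ∑ j, c j * bInt (w j) + d := by
  have hval (j : Fin n) : bInt (w j) = ∑ i, α i * bInt (t i j) := by
    have := hw j
    unfold coeffOp at this
    split_ifs at this with h₁ h₀
    · rw [h₁, ← Option.some.inj this]; rfl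
    · rw [h₀, ← Option.some.inj this]; rfl
  have key : ∑ j, c j * bInt (w j) + d = ∑ i, α i * (∑ j, c j * bInt (t i j) + d) := by
    simp only [hval, mul_add, Finset.sum_add_distrib, ← Finset.sum_mul, hα, one_mul,
      Finset.mul_sum]
    rw [Finset.sum_comm]
    simp only [mul_left_comm]
  rw [key]
  exact Finset.dvd_sum fun i _ => (ht i).mul_left _

/-- The ternary Boolean function with the given truth table. -/
def truthTable (b₀ b₁ b₂ b₃ b₄ b₅ b₆ b₇ x y z : Bool) : Bool :=
  cond x (cond y (cond z b₇ b₆) (cond z b₅ b₄)) (cond y (cond z b₃ b₂) (cond z b₁ b₀))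

/-- No square of the cube (with possibly diagonal sides) has exactly three corners in `p`. -/
abbrev NoThreeCorners (p : Bool → Bool → Bool → Bool) : Prop :=
  ∀ w₀ w₁ w₂, p w₀ w₁ w₂ = false →
  ∀ a₀ a₁ a₂, p (w₀ ^^ a₀) (w₁ ^^ a₁) (w₂ ^^ a₂) = true →
  ∀ b₀ b₁ b₂, p (w₀ ^^ b₀) (w₁ ^^ b₁) (w₂ ^^ b₂) = true →
    (a₀ && b₀ || a₁ && b₁ || a₂ && b₂) = false →
    p (w₀ ^^ a₀ ^^ b₀) (w₁ ^^ a₁ ^^ b₁) (w₂ ^^ a₂ ^^ b₂) = false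

/-- Some affine congruence modulo `q` holds on `p` but fails at `(x, y, z)`. -/
abbrev SeparatedMod (q : ℕ) (p : Bool → Bool → Bool → Bool) (x y z : Bool) : Prop :=
  ∃ c₀ < q, ∃ c₁ < q, ∃ c₂ < q, ∃ d < q,
    (c₀ * x.toNat + c₁ * y.toNat + c₂ * z.toNat + d) % q ≠ 0 ∧
    ∀ u v w, p u v w = true → (c₀ * u.toNat + c₁ * v.toNat + c₂ * w.toNat + d) % q = 0

set_option synthInstance.maxSize 4000 in
lemma truthTable_separated : ∀ b₀ b₁ b₂ b₃ b₄ b₅ b₆ b₇ : Bool,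
    NoThreeCorners (truthTable b₀ b₁ b₂ b₃ b₄ b₅ b₆ b₇) →
    ∀ x y z, truthTable b₀ b₁ b₂ b₃ b₄ b₅ b₆ b₇ x y z = false →
      SeparatedMod 2 (truthTable b₀ b₁ b₂ b₃ b₄ b₅ b₆ b₇) x y z ∨
      SeparatedMod 3 (truthTable b₀ b₁ b₂ b₃ b₄ b₅ b₆ b₇) x y z := by
  decide +kernel

lemma NoThreeCorners.separated {p : Bool → Bool → Bool → Bool} (hp : NoThreeCorners p)
    {x y z : Bool} (h : p x y z = false) : ∃ q, SeparatedMod q p x y z := by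
  have hpt : p = truthTable (p false false false) (p false false true) (p false true false)
      (p false true true) (p true false false) (p true false true) (p true true false)
      (p true true true) := by
    funext u v w
    cases u <;> cases v <;> cases w <;> rfl
  rw [hpt] at hp h ⊢
  exact (truthTable_separated _ _ _ _ _ _ _ _ hp x y z h).elim (⟨2, ·⟩) (⟨3, ·⟩)

/-- Let `U ⊆ {0,1}^3` be a Boolean relation of arity `3` that is not balanced.
Then the `2`-OR relation is cone-definable from `U`. -/
theorem arity_three_not_balanced_coneDefines_twoOR (U : Set (Fin 3 → Bool))
    (hU : ¬ IsBalancedRel U) :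
    ConeDefinable (kOR 2) U := by
  classical
  by_contra hcone
  apply hU
  rintro m _ ⟨α, hα, rfl⟩ t ht w hw
  by_contra hwU
  let p : Bool → Bool → Bool → Bool := fun x y z => decide (![x, y, z] ∈ U)
  have hvec (u : Fin 3 → Bool) : ![u 0, u 1, u 2] = u := by
    funext j; fin_cases j <;> rfl
  have hp (u : Fin 3 → Bool) : p (u 0) (u 1) (u 2) = decide (u ∈ U) := by
    simp only [p, hvec]
  have hcorners : NoThreeCorners p := by
    intro w₀ w₁ w₂ hw a₀ a₁ a₂ ha b₀ b₁ b₂ hb hab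
    by_contra hne
    have hwab : p (w₀ ^^ a₀ ^^ b₀) (w₁ ^^ a₁ ^^ b₁) (w₂ ^^ a₂ ^^ b₂) = true := by simpa using hne
    have hmem {u : Fin 3 → Bool} (h : p (u 0) (u 1) (u 2) = true) : u ∈ U := by
      simpa [hp] using h
    refine hcone (coneDefinable_twoOR_of_square ![w₀, w₁, w₂] ![a₀, a₁, a₂] ![b₀, b₁, b₂]
      ?_ ?_ ?_ (by simpa [p] using hw) (hmem ha) (hmem hb) (hmem hwab))
    · by_contra! h
      simp_all [Fin.forall_fin_succ]
    · by_contra! h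
      simp_all [Fin.forall_fin_succ]
    · simpa [Fin.forall_fin_succ, and_assoc] using hab
  obtain ⟨q, c₀, -, c₁, -, c₂, -, d, -, hne, hall⟩ :=
    hcorners.separated (x := w 0) (y := w 1) (z := w 2) (by simpa [hp] using hwU)
  have hcast (u : Fin 3 → Bool) :
      (q : ℤ) ∣ ∑ j, (![c₀, c₁, c₂] j : ℤ) * bInt (u j) + d ↔
        (c₀ * (u 0).toNat + c₁ * (u 1).toNat + c₂ * (u 2).toNat + d) % q = 0 := by
    have hb (b : Bool) : bInt b = (b.toNat : ℤ) := by cases b <;> rfl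
    rw [← Nat.dvd_iff_mod_eq_zero, ← Int.natCast_dvd_natCast]
    simp [Fin.sum_univ_three, hb]
  refine hne ((hcast w).1 (coeffOp_affine_dvd hα hw _ _ _ fun i => (hcast (t i)).2 ?_))
  exact hall _ _ _ (by simpa [hp] using ht i)
end

section
/- Let U ⊆ {0,1}^n be a Boolean relation and suppose there exist an integer c and a natural number m > 1 such that every tuple u ∈ U satisfies weight(u) ≡ c (mod m). Then every witness w for U satisfies weight(w) ≡ c (mod m). -/
/-- A tuple `w` is a witness for `U` if `w ∉ U`, yet `w` is obtained by applying some
balanced operation coordinatewise to tuples of `U` (defined in every coordinate). -/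
def IsWitness {n : ℕ} (U : Set (Fin n → Bool)) (w : Fin n → Bool) : Prop :=
  w ∉ U ∧ ∃ (m : ℕ) (f : (Fin m → Bool) → Option Bool), IsBalancedOp f ∧
    ∃ t : Fin m → (Fin n → Bool), (∀ i, t i ∈ U) ∧
      ∀ j, f (fun i => t i j) = some (w j)

lemma bInt_eq_of_coeffOp_eq_some {k : ℕ} {α : Fin k → ℤ} {x : Fin k → Bool} {b : Bool}
    (h : coeffOp α x = some b) : bInt b = ∑ i, α i * bInt (x i) := by
  unfold coeffOp at h
  split_ifs at h with h₁ h₀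
  · obtain rfl := Option.some.inj h
    exact h₁.symm
  · obtain rfl := Option.some.inj h
    exact h₀.symm

lemma natCast_wt_eq_sum_bInt {k : ℕ} (x : Fin k → Bool) : (wt x : ℤ) = ∑ i, bInt (x i) := by
  simp [wt, bInt]

/-- The weight is affine with respect to balanced operations. -/
lemma natCast_wt_eq_sum_mul {k n : ℕ} {α : Fin k → ℤ} {t : Fin k → Fin n → Bool}
    {w : Fin n → Bool} (h : ∀ j, coeffOp α (fun i => t i j) = some (w j)) :
    (wt w : ℤ) = ∑ i, α i * (wt (t i) : ℤ) := by
  simp_rw [natCast_wt_eq_sum_bInt, Finset.mul_sum]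
  rw [Finset.sum_comm]
  exact Finset.sum_congr rfl fun j _ => bInt_eq_of_coeffOp_eq_some (h j)

/-- Let `U ⊆ {0,1}^n` be a Boolean relation, and suppose every tuple of `U` has weight
congruent to `c` modulo `m`, for some integer `c` and natural number `m > 1`. Then every
witness `w` for `U` also has weight congruent to `c` modulo `m`. -/
theorem witness_weight_modulo {n : ℕ} (U : Set (Fin n → Bool)) (c : ℤ) (m : ℕ)
    (hm : 1 < m) (hU : ∀ u ∈ U, Int.ModEq (m : ℤ) (wt u : ℤ) c)
    (w : Fin n → Bool) (hw : IsWitness U w) :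
    Int.ModEq (m : ℤ) (wt w : ℤ) c := by
  obtain ⟨-, k, f, ⟨α, hα, rfl⟩, t, ht, hwt⟩ := hw
  have key : Int.ModEq (m : ℤ) (∑ i, α i * (wt (t i) : ℤ)) (∑ i, α i * c) :=
    Int.ModEq.sum fun i _ => (hU (t i) (ht i)).mul_left (α i)
  rwa [← Finset.sum_mul, hα, one_mul, ← natCast_wt_eq_sum_mul hwt] at key
end

section
/- Let U ⊆ {0,1}^n be a Boolean relation, let S ⊆ [n], and suppose f : S → {0,1} is a min-no-good of U. Then f is a min-no-good of the restricted relation U↾S. -/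
/-- A total assignment `g` extends the partial assignment `f` (given as a function to
`Option Bool`, with `none` marking coordinates outside the domain). -/
def ExtendsTo {n : ℕ} (f : Fin n → Option Bool) (g : Fin n → Bool) : Prop :=
  ∀ i (b : Bool), f i = some b → g i = b

/-- The partial assignment `f'` is a restriction of the partial assignment `f`. -/
def RestrictionOf {n : ℕ} (f' f : Fin n → Option Bool) : Prop :=
  ∀ i (b : Bool), f' i = some b → f i = some b

/-- A partial assignment `f` is a no-good of `U` if no extension of `f` lies in `U`,
and some extension of `f` is a witness for `U`. -/
def NoGood {n : ℕ} (U : Set (Fin n → Bool)) (f : Fin n → Option Bool) : Prop :=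
  (∀ g : Fin n → Bool, ExtendsTo f g → g ∉ U) ∧
  (∃ h : Fin n → Bool, ExtendsTo f h ∧ IsWitness U h)

/-- A partial assignment `f` is a min-no-good of `U` if it is a no-good of `U`, but no
proper restriction of `f` is a no-good of `U`. -/
def MinNoGood {n : ℕ} (U : Set (Fin n → Bool)) (f : Fin n → Option Bool) : Prop :=
  NoGood U f ∧
  ∀ f' : Fin n → Option Bool, RestrictionOf f' f → f' ≠ f → ¬ NoGood U f'

/-- The restriction `U ↾ S` of a relation `U ⊆ {0,1}^n` to a set of coordinates
`S = {s_1 < ⋯ < s_m}`: the set of tuples `(h s_1, …, h s_m)` for `h ∈ U`. -/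
def RestrictRel {n : ℕ} (U : Set (Fin n → Bool)) (S : Finset (Fin n)) :
    Set (Fin S.card → Bool) :=
  {v | ∃ h ∈ U, ∀ j : Fin S.card, v j = h ((S.orderIsoOfFin rfl j : Fin n))}

/-- The image of a witness for `U` under restriction to `S` is a witness for `U ↾ S`,
provided that it does not lie in `U ↾ S`. -/
theorem IsWitness.restrictRel {n : ℕ} {U : Set (Fin n → Bool)} {S : Finset (Fin n)}
    {h : Fin n → Bool} (hw : IsWitness U h)
    (hU : (fun j : Fin S.card => h (S.orderIsoOfFin rfl j : Fin n)) ∉ RestrictRel U S) :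
    IsWitness (RestrictRel U S) (fun j => h (S.orderIsoOfFin rfl j : Fin n)) := by
  obtain ⟨-, m, g, hg, t, ht, hgt⟩ := hw
  exact ⟨hU, m, g, hg, fun i j => t i (S.orderIsoOfFin rfl j : Fin n),
    fun i => ⟨t i, ht i, fun _ => rfl⟩, fun j => hgt _⟩

/-- If `f : S → {0,1}` is a min-no-good of `U ⊆ {0,1}^n`, then `f` is a min-no-good of
the restricted relation `U ↾ S`. -/
theorem minNoGood_restrict {n : ℕ} (U : Set (Fin n → Bool)) (S : Finset (Fin n))
    (f : Fin n → Option Bool) (hdom : ∀ i, (f i).isSome ↔ i ∈ S)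
    (hf : MinNoGood U f) :
    MinNoGood (RestrictRel U S)
      (fun j : Fin S.card => f ((S.orderIsoOfFin rfl j : Fin n))) := by
  obtain ⟨⟨hno, h, hext, hw⟩, hmin⟩ := hf
  have hnot : ∀ v : Fin S.card → Bool,
      ExtendsTo (fun j => f (S.orderIsoOfFin rfl j : Fin n)) v → v ∉ RestrictRel U S := by
    rintro v hv ⟨g, hg, hvg⟩
    refine hno g (fun i b hb => ?_) hg
    have hi : i ∈ S := (hdom i).1 (by simp [hb])
    obtain ⟨j, hj⟩ := (S.orderIsoOfFin rfl).surjective ⟨i, hi⟩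
    have hji : (S.orderIsoOfFin rfl j : Fin n) = i := congrArg Subtype.val hj
    rw [← hji] at hb ⊢
    rw [← hvg j]
    exact hv j b hb
  have hres : ExtendsTo (fun j => f (S.orderIsoOfFin rfl j : Fin n))
      (fun j => h (S.orderIsoOfFin rfl j : Fin n)) := fun j b hb => hext _ b hb
  refine ⟨⟨hnot, _, hres, hw.restrictRel (hnot _ hres)⟩, fun f' hf' hne hng => ?_⟩
  let F : Fin n → Option Bool := fun i =>
    if hi : i ∈ S then f' ((S.orderIsoOfFin rfl).symm ⟨i, hi⟩) else none
  have hF : ∀ j, F (S.orderIsoOfFin rfl j : Fin n) = f' j := fun j => by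
    have hj : (S.orderIsoOfFin rfl j : Fin n) ∈ S := (S.orderIsoOfFin rfl j).2
    simp only [F, dif_pos hj, Subtype.coe_eta, OrderIso.symm_apply_apply]
  have hFf : RestrictionOf F f := fun i b hb => by
    by_cases hi : i ∈ S
    · simp only [F, dif_pos hi] at hb
      simpa only [OrderIso.apply_symm_apply] using hf' _ b hb
    · simp [F, hi] at hb
  refine hmin F hFf (fun hEq => hne (funext fun j => by rw [← hF j, hEq])) ⟨fun g hg hgU => ?_, h,
    fun i b hb => hext i b (hFf i b hb), hw⟩
  exact hng.1 (fun j => g (S.orderIsoOfFin rfl j : Fin n))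
    (fun j b hb => hg _ b ((hF j).trans hb)) ⟨g, hgU, fun _ => rfl⟩
end

section
/- Suppose a Boolean relation T is cone-definable from a Boolean relation U, and let g be a partial Boolean operation that is idempotent and self-dual. If g preserves U, then g preserves T. -/
/-- A partial Boolean operation is idempotent if it maps the all-zeros tuple to `0`
and the all-ones tuple to `1`. -/
def IsIdempotentOp {k : ℕ} (g : (Fin k → Bool) → Option Bool) : Prop :=
  g (fun _ => false) = some false ∧ g (fun _ => true) = some true

/-- A partial Boolean operation is self-dual if whenever it is defined on a tuple, it is
also defined on the complemented tuple, with complemented value. -/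
def IsSelfDualOp {k : ℕ} (g : (Fin k → Bool) → Option Bool) : Prop :=
  ∀ (x : Fin k → Bool) (b : Bool), g x = some b → g (fun i => !(x i)) = some (!b)

/-- Suppose a Boolean relation `T` is cone-definable from a Boolean relation `U`, and
`g` is an idempotent, self-dual partial Boolean operation. If `g` preserves `U`, then
`g` preserves `T`. -/
theorem preserves_of_coneDefinable {m n k : ℕ} (T : Set (Fin m → Bool))
    (U : Set (Fin n → Bool)) (hTU : ConeDefinable T U)
    (g : (Fin k → Bool) → Option Bool)
    (hid : IsIdempotentOp g) (hsd : IsSelfDualOp g)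
    (hU : Preserves g U) : Preserves g T := by
  obtain ⟨y, -, hy⟩ := hTU
  intro t ht w hw
  refine (hy w).2 (hU (fun i j => (y j).eval (t i)) (fun i => (hy (t i)).1 (ht i)) _ fun j => ?_)
  match y j with
  | .const false => exact hid.1
  | .const true => exact hid.2
  | .pos i => exact hw i
  | .neg i => exact hsd _ _ (hw i)
end

section
/- Suppose T and U are Boolean relations that are cone-interdefinable, and let g be a partial Boolean operation that is idempotent and self-dual. Then g preserves T if and only if g preserves U. -/
theorem ConeEntry.op_eval {m k : ℕ} {g : (Fin k → Bool) → Option Bool}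
    (hid : IsIdempotentOp g) (hsd : IsSelfDualOp g) {t : Fin k → (Fin m → Bool)}
    {w : Fin m → Bool} (hw : ∀ i, g (fun l => t l i) = some (w i)) :
    ∀ e : ConeEntry m, g (fun l => e.eval (t l)) = some (e.eval w)
  | .const false => hid.1
  | .const true => hid.2
  | .pos i => hw i
  | .neg i => hsd _ _ (hw i)

theorem Preserves.of_coneDefinable {m n k : ℕ} {T : Set (Fin m → Bool)}
    {U : Set (Fin n → Bool)} (hTU : ConeDefinable T U) {g : (Fin k → Bool) → Option Bool}
    (hid : IsIdempotentOp g) (hsd : IsSelfDualOp g) (hU : Preserves g U) :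
    Preserves g T := by
  obtain ⟨y, -, hy⟩ := hTU
  intro t ht w hw
  exact (hy w).2 (hU (fun l j => (y j).eval (t l)) (fun l => (hy (t l)).1 (ht l)) _
    fun j => ConeEntry.op_eval hid hsd hw (y j))

/-- Suppose `T` and `U` are cone-interdefinable Boolean relations, and `g` is an
idempotent, self-dual partial Boolean operation. Then `g` preserves `T` if and only if
`g` preserves `U`. -/
theorem preserves_iff_of_coneInterdefinable {m n k : ℕ} (T : Set (Fin m → Bool))
    (U : Set (Fin n → Bool)) (hTU : ConeDefinable T U) (hUT : ConeDefinable U T)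
    (g : (Fin k → Bool) → Option Bool)
    (hid : IsIdempotentOp g) (hsd : IsSelfDualOp g) :
    Preserves g T ↔ Preserves g U := by
  exact ⟨.of_coneDefinable hUT hid hsd, .of_coneDefinable hTU hid hsd⟩
end
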